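/- arXiv:1210.7291 — 3 statements merged into one kernel-verified Lean document; each statement's English description precedes it below -/
import Mathlib

section
/- Let (n_k)_{k≥1} be a sequence of integers with n₁ ≥ 3 and n_{k+1} ≥ 12 n_k² for all k ≥ 1, let K ≥ 1, and let A = ∪_{k=1}^{K} A(n_k). Suppose j₁, j₂, j₃, ℓ₁, ℓ₂, ℓ₃ ∈ A satisfy j₁ + j₂ + j₃ = ℓ₁ + ℓ₂ + ℓ₃ and j₁² + j₂² + j₃² = ℓ₁² + ℓ₂² + ℓ₃², and the multiset {j₁, j₂, j₃} is not equal to the multiset {ℓ₁, ℓ₂, ℓ₃}. Then there exists 1 ≤ k ≤ K such that all six integers j₁, j₂, j₃, ℓ₁, ℓ₂, ℓ₃ belong to the single cluster A(n_k). -/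
/-- For an integer `n`, the resonant cluster `A(n) = {n-2, n-1, n+1, n+2}`. -/
def resonantCluster (n : ℤ) : Set ℤ := {n - 2, n - 1, n + 1, n + 2}

theorem eq_or_swap_of_add_eq_of_sq_add_sq_eq {a b c d : ℤ} (h : a + b = c + d)
    (hsq : a ^ 2 + b ^ 2 = c ^ 2 + d ^ 2) : (a = c ∧ b = d) ∨ (a = d ∧ b = c) := by
  have hprod : (a - c) * (a - d) = 0 := by
    have hb : b = c + d - a := by linarith
    subst hb
    linarith
  rcases mul_eq_zero.mp hprod with h0 | h0
  · left; omega
  · right; omega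

/-- A resonance with exactly one large element on each side is trivial. -/
theorem eq_of_resonance_of_one_large {m N a b c a' b' c' : ℤ} (hm : 3 ≤ m)
    (hN : 12 * m ^ 2 ≤ N) (ha : N - 2 ≤ a) (ha' : N - 2 ≤ a')
    (hb : 1 ≤ b ∧ b ≤ m + 2) (hc : 1 ≤ c ∧ c ≤ m + 2)
    (hb' : 1 ≤ b' ∧ b' ≤ m + 2) (hc' : 1 ≤ c' ∧ c' ≤ m + 2)
    (hsum : a + b + c = a' + b' + c')
    (hsq : a ^ 2 + b ^ 2 + c ^ 2 = a' ^ 2 + b' ^ 2 + c' ^ 2) :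
    a = a' ∧ ((b = b' ∧ c = c') ∨ (b = c' ∧ c = b')) := by
  have hle {x : ℤ} (hx : 1 ≤ x ∧ x ≤ m + 2) : x ^ 2 ≤ (m + 2) ^ 2 :=
    pow_le_pow_left₀ (by linarith [hx.1]) hx.2 2
  have hbsq := hle hb
  have hcsq := hle hc
  have hbsq' := hle hb'
  have hcsq' := hle hc'
  have haa : a = a' := by
    rcases lt_trichotomy a a' with h | h | h
    · nlinarith [mul_nonneg (by omega : 0 ≤ a' - a - 1) (by nlinarith : 0 ≤ a + a'),
        sq_nonneg b', sq_nonneg c']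
    · exact h
    · nlinarith [mul_nonneg (by omega : 0 ≤ a - a' - 1) (by nlinarith : 0 ≤ a + a'),
        sq_nonneg b, sq_nonneg c]
  subst haa
  exact ⟨rfl, eq_or_swap_of_add_eq_of_sq_add_sq_eq (by linarith) (by linarith)⟩

/-- A resonance with exactly two large elements on each side is trivial. -/
theorem eq_of_resonance_of_two_large {m N a b c a' b' c' : ℤ} (hm : 3 ≤ m)
    (hN : 12 * m ^ 2 ≤ N) (ha : N - 2 ≤ a ∧ a ≤ N + 2) (hb : N - 2 ≤ b ∧ b ≤ N + 2)
    (ha' : N - 2 ≤ a' ∧ a' ≤ N + 2) (hb' : N - 2 ≤ b' ∧ b' ≤ N + 2)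
    (hc : 1 ≤ c ∧ c ≤ m + 2) (hc' : 1 ≤ c' ∧ c' ≤ m + 2)
    (hsum : c + a + b = c' + a' + b')
    (hsq : c ^ 2 + a ^ 2 + b ^ 2 = c' ^ 2 + a' ^ 2 + b' ^ 2) :
    c = c' ∧ ((a = a' ∧ b = b') ∨ (a = b' ∧ b = a')) := by
  have hle {x : ℤ} (hx : 1 ≤ x ∧ x ≤ m + 2) : x ^ 2 ≤ (m + 2) ^ 2 :=
    pow_le_pow_left₀ (by linarith [hx.1]) hx.2 2
  have hoff {x : ℤ} (hx : N - 2 ≤ x ∧ x ≤ N + 2) : (x - N) ^ 2 ≤ 4 := by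
    nlinarith [mul_nonneg (sub_nonneg.mpr hx.1) (sub_nonneg.mpr hx.2)]
  have hcsq := hle hc
  have hcsq' := hle hc'
  have hid : 2 * N * (c' - c) + ((a - N) ^ 2 + (b - N) ^ 2)
      = ((a' - N) ^ 2 + (b' - N) ^ 2) + (c' ^ 2 - c ^ 2) := by
    linear_combination hsq - 2 * N * hsum
  have hNpos : 0 ≤ N := by nlinarith
  have hcc : c = c' := by
    rcases lt_trichotomy c c' with h | h | h
    · nlinarith [mul_nonneg hNpos (by omega : 0 ≤ c' - c - 1), hoff ha', hoff hb',
        sq_nonneg (a - N), sq_nonneg (b - N), sq_nonneg c]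
    · exact h
    · nlinarith [mul_nonneg hNpos (by omega : 0 ≤ c - c' - 1), hoff ha, hoff hb,
        sq_nonneg (a' - N), sq_nonneg (b' - N), sq_nonneg c']
  subst hcc
  exact ⟨rfl, eq_or_swap_of_add_eq_of_sq_add_sq_eq (by linarith) (by linarith)⟩

theorem triple_eq_of_head_eq_of_tail_eq_or_swap {a b c a' b' c' : ℤ}
    (h : a = a' ∧ ((b = b' ∧ c = c') ∨ (b = c' ∧ c = b'))) :
    ({a, b, c} : Multiset ℤ) = {a', b', c'} := by
  obtain ⟨rfl, ⟨rfl, rfl⟩ | ⟨rfl, rfl⟩⟩ := h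
  · rfl
  · exact congrArg (a ::ₘ ·) (Multiset.pair_comm _ _)

theorem triple_rotate (a b c : ℤ) : ({a, b, c} : Multiset ℤ) = {b, c, a} := by
  change a ::ₘ b ::ₘ {c} = b ::ₘ c ::ₘ {a}
  rw [Multiset.cons_swap]
  exact congrArg (b ::ₘ ·) (Multiset.pair_comm _ _)

/-- Three integers each satisfying `P` or `Q` either agree, or can be reordered so that the
first one is the odd one out. -/
theorem all_or_all_or_exists_odd_one_out {P Q : ℤ → Prop} {a b c : ℤ}
    (ha : P a ∨ Q a) (hb : P b ∨ Q b) (hc : P c ∨ Q c) :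
    (P a ∧ P b ∧ P c) ∨ (Q a ∧ Q b ∧ Q c) ∨
      ∃ x y z, ({a, b, c} : Multiset ℤ) = {x, y, z} ∧ x + y + z = a + b + c ∧
        x ^ 2 + y ^ 2 + z ^ 2 = a ^ 2 + b ^ 2 + c ^ 2 ∧
        ((P x ∧ Q y ∧ Q z) ∨ (Q x ∧ P y ∧ P z)) := by
  rcases ha with ha | ha <;> rcases hb with hb | hb <;> rcases hc with hc | hc
  · exact Or.inl ⟨ha, hb, hc⟩
  · exact Or.inr (Or.inr ⟨c, a, b, (triple_rotate c a b).symm, by ring, by ring,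
      Or.inr ⟨hc, ha, hb⟩⟩)
  · exact Or.inr (Or.inr ⟨b, c, a, triple_rotate a b c, by ring, by ring,
      Or.inr ⟨hb, hc, ha⟩⟩)
  · exact Or.inr (Or.inr ⟨a, b, c, rfl, rfl, rfl,
      Or.inl ⟨ha, hb, hc⟩⟩)
  · exact Or.inr (Or.inr ⟨a, b, c, rfl, rfl, rfl,
      Or.inr ⟨ha, hb, hc⟩⟩)
  · exact Or.inr (Or.inr ⟨b, c, a, triple_rotate a b c, by ring, by ring,
      Or.inl ⟨hb, hc, ha⟩⟩)
  · exact Or.inr (Or.inr ⟨c, a, b, (triple_rotate c a b).symm, by ring, by ring,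
      Or.inl ⟨hc, ha, hb⟩⟩)
  · exact Or.inr (Or.inl ⟨ha, hb, hc⟩)

/-- In a nontrivial resonance among integers that are either within `2` of `N` or in
`[1, m + 2]`, with `12 * m ^ 2 ≤ N`, all six elements are on the same scale. -/
theorem all_large_or_all_small_of_resonance {m N j₁ j₂ j₃ ℓ₁ ℓ₂ ℓ₃ : ℤ} (hm : 3 ≤ m)
    (hN : 12 * m ^ 2 ≤ N)
    (hj₁ : (N - 2 ≤ j₁ ∧ j₁ ≤ N + 2) ∨ (1 ≤ j₁ ∧ j₁ ≤ m + 2))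
    (hj₂ : (N - 2 ≤ j₂ ∧ j₂ ≤ N + 2) ∨ (1 ≤ j₂ ∧ j₂ ≤ m + 2))
    (hj₃ : (N - 2 ≤ j₃ ∧ j₃ ≤ N + 2) ∨ (1 ≤ j₃ ∧ j₃ ≤ m + 2))
    (hℓ₁ : (N - 2 ≤ ℓ₁ ∧ ℓ₁ ≤ N + 2) ∨ (1 ≤ ℓ₁ ∧ ℓ₁ ≤ m + 2))
    (hℓ₂ : (N - 2 ≤ ℓ₂ ∧ ℓ₂ ≤ N + 2) ∨ (1 ≤ ℓ₂ ∧ ℓ₂ ≤ m + 2))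
    (hℓ₃ : (N - 2 ≤ ℓ₃ ∧ ℓ₃ ≤ N + 2) ∨ (1 ≤ ℓ₃ ∧ ℓ₃ ≤ m + 2))
    (hsum : j₁ + j₂ + j₃ = ℓ₁ + ℓ₂ + ℓ₃)
    (hsq : j₁ ^ 2 + j₂ ^ 2 + j₃ ^ 2 = ℓ₁ ^ 2 + ℓ₂ ^ 2 + ℓ₃ ^ 2)
    (hne : ({j₁, j₂, j₃} : Multiset ℤ) ≠ {ℓ₁, ℓ₂, ℓ₃}) :
    (N - 2 ≤ j₁ ∧ N - 2 ≤ j₂ ∧ N - 2 ≤ j₃ ∧ N - 2 ≤ ℓ₁ ∧ N - 2 ≤ ℓ₂ ∧ N - 2 ≤ ℓ₃) ∨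
      (j₁ ≤ m + 2 ∧ j₂ ≤ m + 2 ∧ j₃ ≤ m + 2 ∧ ℓ₁ ≤ m + 2 ∧ ℓ₂ ≤ m + 2 ∧ ℓ₃ ≤ m + 2) := by
  have hNm : 36 * m ≤ N := by nlinarith
  rcases all_or_all_or_exists_odd_one_out (P := fun x => N - 2 ≤ x ∧ x ≤ N + 2)
      (Q := fun x => 1 ≤ x ∧ x ≤ m + 2) hj₁ hj₂ hj₃ with
    hj | hj | ⟨a, b, c, hj, hjs, hjq, hjx | hjx⟩ <;>
  rcases all_or_all_or_exists_odd_one_out (P := fun x => N - 2 ≤ x ∧ x ≤ N + 2)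
      (Q := fun x => 1 ≤ x ∧ x ≤ m + 2) hℓ₁ hℓ₂ hℓ₃ with
    hℓ | hℓ | ⟨a', b', c', hℓ, hℓs, hℓq, hℓx | hℓx⟩ <;>
  first
  | omega
  | refine absurd (hj.trans (Eq.trans ?_ hℓ.symm)) hne
    apply triple_eq_of_head_eq_of_tail_eq_or_swap
  · exact eq_of_resonance_of_one_large hm hN hjx.1.1 hℓx.1.1 hjx.2.1 hjx.2.2 hℓx.2.1 hℓx.2.2
      (by linarith) (by linarith)
  · exact eq_of_resonance_of_two_large hm hN hjx.2.1 hjx.2.2 hℓx.2.1 hℓx.2.2 hjx.1 hℓx.1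
      (by linarith) (by linarith)

theorem mem_resonantCluster {x n : ℤ} :
    x ∈ resonantCluster n ↔ x = n - 2 ∨ x = n - 1 ∨ x = n + 1 ∨ x = n + 2 := by
  simp [resonantCluster]

theorem bounds_of_mem_resonantCluster {x n : ℤ} (h : x ∈ resonantCluster n) :
    n - 2 ≤ x ∧ x ≤ n + 2 := by
  rw [mem_resonantCluster] at h
  omega

/-- If `(n_k)` satisfies `n₁ ≥ 3` and `n_{k+1} ≥ 12 n_k²`, and six elements of
`A = ∪_{k=1}^K A(n_k)` form a nontrivial resonance (equal sums and equal sums of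
squares, but the two triples do not coincide as multisets), then all six elements
belong to a single cluster `A(n_k)`. -/
theorem resonance_in_single_cluster
    (n : ℕ → ℤ) (hn1 : 3 ≤ n 1) (hngrow : ∀ k, 1 ≤ k → 12 * (n k) ^ 2 ≤ n (k + 1))
    (K : ℕ) (hK : 1 ≤ K)
    (j₁ j₂ j₃ ℓ₁ ℓ₂ ℓ₃ : ℤ)
    (hj₁ : ∃ k, 1 ≤ k ∧ k ≤ K ∧ j₁ ∈ resonantCluster (n k))
    (hj₂ : ∃ k, 1 ≤ k ∧ k ≤ K ∧ j₂ ∈ resonantCluster (n k))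
    (hj₃ : ∃ k, 1 ≤ k ∧ k ≤ K ∧ j₃ ∈ resonantCluster (n k))
    (hℓ₁ : ∃ k, 1 ≤ k ∧ k ≤ K ∧ ℓ₁ ∈ resonantCluster (n k))
    (hℓ₂ : ∃ k, 1 ≤ k ∧ k ≤ K ∧ ℓ₂ ∈ resonantCluster (n k))
    (hℓ₃ : ∃ k, 1 ≤ k ∧ k ≤ K ∧ ℓ₃ ∈ resonantCluster (n k))
    (hsum : j₁ + j₂ + j₃ = ℓ₁ + ℓ₂ + ℓ₃)
    (hsq : j₁ ^ 2 + j₂ ^ 2 + j₃ ^ 2 = ℓ₁ ^ 2 + ℓ₂ ^ 2 + ℓ₃ ^ 2)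
    (hne : ({j₁, j₂, j₃} : Multiset ℤ) ≠ ({ℓ₁, ℓ₂, ℓ₃} : Multiset ℤ)) :
    ∃ k, 1 ≤ k ∧ k ≤ K ∧
      j₁ ∈ resonantCluster (n k) ∧ j₂ ∈ resonantCluster (n k) ∧
      j₃ ∈ resonantCluster (n k) ∧ ℓ₁ ∈ resonantCluster (n k) ∧
      ℓ₂ ∈ resonantCluster (n k) ∧ ℓ₃ ∈ resonantCluster (n k) := by
  have hstep {k : ℕ} (hk : 1 ≤ k) (h3 : 3 ≤ n k) : n k ≤ n (k + 1) := by
    nlinarith [hngrow k hk]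
  have hge {k : ℕ} (hk : 1 ≤ k) : 3 ≤ n k := by
    induction k, hk using Nat.le_induction with
    | base => exact hn1
    | succ k hk ih => exact ih.trans (hstep hk ih)
  have hmono {k l : ℕ} (hk : 1 ≤ k) (hkl : k ≤ l) : n k ≤ n l := by
    induction l, hkl using Nat.le_induction with
    | base => exact le_rfl
    | succ l hl ih => exact ih.trans (hstep (hk.trans hl) (hge (hk.trans hl)))
  induction K, hK using Nat.le_induction with
  | base =>
    have hmem {x : ℤ} (hx : ∃ k, 1 ≤ k ∧ k ≤ 1 ∧ x ∈ resonantCluster (n k)) :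
        x ∈ resonantCluster (n 1) := by
      obtain ⟨k, hk, hk', hx⟩ := hx
      rwa [le_antisymm hk' hk] at hx
    exact ⟨1, le_rfl, le_rfl, hmem hj₁, hmem hj₂, hmem hj₃, hmem hℓ₁, hmem hℓ₂, hmem hℓ₃⟩
  | succ K hK ih =>
    have hm := hge hK
    have hN := hngrow K hK
    have hlow {x : ℤ} (hx : ∃ k, 1 ≤ k ∧ k ≤ K ∧ x ∈ resonantCluster (n k)) :
        1 ≤ x ∧ x ≤ n K + 2 := by
      obtain ⟨k, hk, hkK, hx⟩ := hx
      have := bounds_of_mem_resonantCluster hx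
      have := hge hk
      have := hmono hk hkK
      omega
    have hsplit {x : ℤ} (hx : ∃ k, 1 ≤ k ∧ k ≤ K + 1 ∧ x ∈ resonantCluster (n k)) :
        x ∈ resonantCluster (n (K + 1)) ∨
          ∃ k, 1 ≤ k ∧ k ≤ K ∧ x ∈ resonantCluster (n k) := by
      obtain ⟨k, hk, hkK, hx⟩ := hx
      rcases Nat.le_succ_iff.mp hkK with h | rfl
      · exact Or.inr ⟨k, hk, h, hx⟩
      · exact Or.inl hx
    have hrange {x : ℤ} (hx : ∃ k, 1 ≤ k ∧ k ≤ K + 1 ∧ x ∈ resonantCluster (n k)) :=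
      (hsplit hx).imp bounds_of_mem_resonantCluster hlow
    have hgap : n K + 2 < n (K + 1) - 2 := by nlinarith
    have htop {x : ℤ} (hx : ∃ k, 1 ≤ k ∧ k ≤ K + 1 ∧ x ∈ resonantCluster (n k))
        (h : n (K + 1) - 2 ≤ x) : x ∈ resonantCluster (n (K + 1)) :=
      (hsplit hx).resolve_right fun h' => by linarith [(hlow h').2]
    have hbot {x : ℤ} (hx : ∃ k, 1 ≤ k ∧ k ≤ K + 1 ∧ x ∈ resonantCluster (n k))
        (h : x ≤ n K + 2) : ∃ k, 1 ≤ k ∧ k ≤ K ∧ x ∈ resonantCluster (n k) :=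
      (hsplit hx).resolve_left fun h' => by
        linarith [(bounds_of_mem_resonantCluster h').1]
    rcases all_large_or_all_small_of_resonance hm hN (hrange hj₁) (hrange hj₂) (hrange hj₃)
        (hrange hℓ₁) (hrange hℓ₂) (hrange hℓ₃) hsum hsq hne with
      ⟨h₁, h₂, h₃, h₄, h₅, h₆⟩ | ⟨h₁, h₂, h₃, h₄, h₅, h₆⟩
    · exact ⟨K + 1, by omega, le_rfl, htop hj₁ h₁, htop hj₂ h₂, htop hj₃ h₃, htop hℓ₁ h₄,
        htop hℓ₂ h₅, htop hℓ₃ h₆⟩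
    · obtain ⟨k, hk, hkK, h⟩ := ih (hbot hj₁ h₁) (hbot hj₂ h₂) (hbot hj₃ h₃) (hbot hℓ₁ h₄)
        (hbot hℓ₂ h₅) (hbot hℓ₃ h₆)
      exact ⟨k, hk, by omega, h⟩
end

section
/- Fix a real parameter C ≥ 9. There exists γ ∈ (0, 1/2) such that for every K₀ with γ < K₀ < 1−γ and K₀ ≠ 1/2, there exist T > 0 and a differentiable function (φ, K) : ℝ → ℝ × (0,1) solving the planar system φ′ = −(9/4)(1−2K)[C + 6(K(1−K))^{1/2} cos(2φ)], K′ = −18(K(1−K))^{3/2} sin(2φ), with φ(0) = 0 and K(0) = K₀, such that both φ and K are periodic with period 2T and K(0) + K(T) = 1. -/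
open Set in
/-- A bounded Lipschitz vector field on a Banach space has global integral curves. -/
theorem exists_integralCurve_of_lipschitzWith_of_bounded {E : Type*} [NormedAddCommGroup E]
    [NormedSpace ℝ E] [CompleteSpace E] {f : E → E} {M L : NNReal}
    (hf : LipschitzWith M f) (hL : ∀ x, ‖f x‖ ≤ L) (x : E) :
    ∃ α : ℝ → E, α 0 = x ∧ ∀ t, HasDerivAt α (f (α t)) t := by
  have local_curve (n : ℕ) : ∃ α : ℝ → E, α 0 = x ∧
      ∀ t ∈ Ioo (-(n + 1 : ℝ)) (n + 1), HasDerivAt α (f (α t)) t := by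
    have hn : (0 : ℝ) ∈ Icc (-(n + 1 : ℝ)) (n + 1) := ⟨by linarith, by positivity⟩
    have hpl : IsPicardLindelof (fun _ ↦ f) (⟨0, hn⟩ : Icc (-(n + 1 : ℝ)) (n + 1)) x
        (L * (n + 1)) 0 L M :=
      .of_time_independent (fun y _ ↦ hL y) hf.lipschitzOnWith (by simp)
    obtain ⟨α, h₀, hα⟩ := hpl.exists_eq_forall_mem_Icc_hasDerivWithinAt₀
    exact ⟨α, h₀, fun t ht ↦ (hα t (Ioo_subset_Icc_self ht)).hasDerivAt (Icc_mem_nhds ht.1 ht.2)⟩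
  choose α h₀ hα using local_curve
  have agree {m n : ℕ} (hmn : m ≤ n) : EqOn (α m) (α n) (Ioo (-(m + 1 : ℝ)) (m + 1)) := by
    have hmn' : (m : ℝ) ≤ n := by exact_mod_cast hmn
    refine ODE_solution_unique_of_mem_Ioo (v := fun _ ↦ f) (s := fun _ ↦ univ) (K := M) (t₀ := 0)
      (fun _ _ ↦ hf.lipschitzOnWith) ⟨by linarith, by positivity⟩
      (fun t ht ↦ ⟨hα m t ht, mem_univ _⟩)
      (fun t ht ↦ ⟨hα n t ⟨by linarith [ht.1], by linarith [ht.2]⟩, mem_univ _⟩) ?_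
    rw [h₀, h₀]
  refine ⟨fun t ↦ α ⌈|t|⌉₊ t, h₀ _, fun t ↦ ?_⟩
  have glue (s : ℝ) (n : ℕ) (hs : ⌈|s|⌉₊ ≤ n) : α ⌈|s|⌉₊ s = α n s := by
    refine agree hs (abs_lt.mp ?_)
    linarith [Nat.le_ceil |s|]
  have ht : |t| < (⌈|t|⌉₊ + 1 : ℕ) := by
    push_cast
    linarith [Nat.le_ceil |t|]
  have hev : (fun s ↦ α ⌈|s|⌉₊ s) =ᶠ[nhds t] α (⌈|t|⌉₊ + 1) := by
    filter_upwards [(isOpen_lt continuous_abs continuous_const).mem_nhds ht] with s hs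
    exact glue s _ (Nat.ceil_le.mpr (le_of_lt hs))
  have hd := hα (⌈|t|⌉₊ + 1) t (abs_lt.mp (ht.trans (by linarith)))
  rw [← hev.eq_of_nhds] at hd
  exact hd.congr_of_eventuallyEq hev

/-- A continuous nowhere vanishing real function that is positive somewhere is positive. -/
theorem Continuous.pos_of_ne_zero {f : ℝ → ℝ} (hf : Continuous f) {a : ℝ} (ha : 0 < f a)
    (h : ∀ t, f t ≠ 0) (t : ℝ) : 0 < f t := by
  by_contra! ht
  obtain ⟨s, hs⟩ := mem_range_of_exists_le_of_exists_ge hf ⟨t, ht⟩ ⟨a, ha.le⟩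
  exact h s hs

/-- The beating vector field in the coordinates `(φ, θ)`, where `K = (1 + sin θ) / 2`. -/
noncomputable def beatingField (C : ℝ) (p : ℝ × ℝ) : ℝ × ℝ :=
  (9 / 4 * Real.sin p.2 * (C + 3 * Real.cos p.2 * Real.cos (2 * p.1)),
    -(9 / 2) * Real.cos p.2 ^ 2 * Real.sin (2 * p.1))

namespace beatingField

open Real

theorem eq_sum_sin (C : ℝ) (p : ℝ × ℝ) :
    beatingField C p =
      (9 / 4 * C * sin p.2 + 27 / 16 * (sin (2 * p.2 + 2 * p.1) + sin (2 * p.2 - 2 * p.1)),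
        -(9 / 4) * sin (2 * p.1)
          - 9 / 8 * (sin (2 * p.2 + 2 * p.1) - sin (2 * p.2 - 2 * p.1))) := by
  simp only [beatingField, sin_add, sin_sub, cos_two_mul p.2, sin_two_mul p.2]
  ext <;> ring

theorem norm_le {C : ℝ} (hC : 0 ≤ C) (p : ℝ × ℝ) :
    ‖beatingField C p‖ ≤ 9 / 4 * C + 5 := by
  have hb (x : ℝ) : -1 ≤ sin x ∧ sin x ≤ 1 := ⟨neg_one_le_sin x, sin_le_one x⟩
  have hd := hb (2 * p.1)
  have ha := hb (2 * p.2 + 2 * p.1)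
  have hs := hb (2 * p.2 - 2 * p.1)
  have ht₁ := mul_le_mul_of_nonneg_left (hb p.2).1 hC
  have ht₂ := mul_le_mul_of_nonneg_left (hb p.2).2 hC
  rw [eq_sum_sin]
  refine max_le ?_ ?_ <;> rw [norm_eq_abs, abs_le] <;> constructor <;> linarith

theorem lipschitzWith {C : ℝ} (hC : 0 ≤ C) :
    LipschitzWith (9 / 4 * C + 14).toNNReal (beatingField C) := by
  refine LipschitzWith.of_dist_le_mul fun p q ↦ ?_
  rw [coe_toNNReal _ (by linarith), eq_sum_sin, eq_sum_sin]
  have h₁ : |p.1 - q.1| ≤ dist p q := le_max_left (dist p.1 q.1) (dist p.2 q.2)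
  have h₂ : |p.2 - q.2| ≤ dist p q := le_max_right (dist p.1 q.1) (dist p.2 q.2)
  generalize dist p q = D at h₁ h₂ ⊢
  have hD : 0 ≤ D := (abs_nonneg _).trans h₁
  have hsin (x y : ℝ) {c : ℝ} (h : |x - y| ≤ c) : -c ≤ sin x - sin y ∧ sin x - sin y ≤ c :=
    abs_le.mp ((abs_sin_sub_sin_le x y).trans h)
  rw [abs_le] at h₁ h₂
  have ht := hsin p.2 q.2 (abs_le.mpr h₂)
  have hd := hsin (2 * p.1) (2 * q.1) (c := 2 * D) (abs_le.mpr (by constructor <;> linarith))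
  have ha := hsin (2 * p.2 + 2 * p.1) (2 * q.2 + 2 * q.1) (c := 4 * D)
    (abs_le.mpr (by constructor <;> linarith))
  have hs := hsin (2 * p.2 - 2 * p.1) (2 * q.2 - 2 * q.1) (c := 4 * D)
    (abs_le.mpr (by constructor <;> linarith))
  have ht₁ := mul_le_mul_of_nonneg_left ht.1 hC
  have ht₂ := mul_le_mul_of_nonneg_left ht.2 hC
  refine max_le ?_ ?_ <;> rw [dist_eq, abs_le] <;> constructor <;> linarith

/-- Integral curves of the beating field that agree at one time are equal. -/
theorem integralCurve_unique {C : ℝ} (hC : 0 ≤ C) {φ θ φ' θ' : ℝ → ℝ}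
    (h : ∀ t, HasDerivAt (fun t ↦ (φ t, θ t)) (beatingField C (φ t, θ t)) t)
    (h' : ∀ t, HasDerivAt (fun t ↦ (φ' t, θ' t)) (beatingField C (φ' t, θ' t)) t)
    {t₀ : ℝ} (hφ : φ t₀ = φ' t₀) (hθ : θ t₀ = θ' t₀) (t : ℝ) : φ t = φ' t ∧ θ t = θ' t := by
  have := ODE_solution_unique_univ (v := fun _ ↦ beatingField C) (s := fun _ ↦ Set.univ)
    (t₀ := t₀) (fun _ ↦ (lipschitzWith hC).lipschitzOnWith) (fun t ↦ ⟨h t, Set.mem_univ _⟩)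
    (fun t ↦ ⟨h' t, Set.mem_univ _⟩) (Prod.ext hφ hθ)
  exact Prod.mk.inj (congrFun this t)

theorem hasDerivAt_fst {C : ℝ} {φ θ : ℝ → ℝ} {t : ℝ}
    (h : HasDerivAt (fun t ↦ (φ t, θ t)) (beatingField C (φ t, θ t)) t) :
    HasDerivAt φ (9 / 4 * sin (θ t) * (C + 3 * cos (θ t) * cos (2 * φ t))) t := by
  simpa [beatingField] using! h.hasFDerivAt.fst.hasDerivAt

theorem hasDerivAt_snd {C : ℝ} {φ θ : ℝ → ℝ} {t : ℝ}
    (h : HasDerivAt (fun t ↦ (φ t, θ t)) (beatingField C (φ t, θ t)) t) :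
    HasDerivAt θ (-(9 / 2) * cos (θ t) ^ 2 * sin (2 * φ t)) t := by
  simpa [beatingField] using! h.hasFDerivAt.snd.hasDerivAt

theorem hasDerivAt_neg {C : ℝ} {φ θ : ℝ → ℝ}
    (h : ∀ t, HasDerivAt (fun t ↦ (φ t, θ t)) (beatingField C (φ t, θ t)) t) (t : ℝ) :
    HasDerivAt (fun t ↦ (-φ t, -θ t)) (beatingField C (-φ t, -θ t)) t := by
  convert! (h t).neg using 1
  simp [beatingField]

theorem hasDerivAt_reflect {C : ℝ} {φ θ : ℝ → ℝ}
    (h : ∀ t, HasDerivAt (fun t ↦ (φ t, θ t)) (beatingField C (φ t, θ t)) t) (s t : ℝ) :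
    HasDerivAt (fun t ↦ (φ (s - t), -θ (s - t))) (beatingField C (φ (s - t), -θ (s - t))) t := by
  have h₁ := (hasDerivAt_fst (h (s - t))).comp_const_sub s t
  have h₂ := ((hasDerivAt_snd (h (s - t))).comp_const_sub s t).neg
  convert! h₁.prodMk h₂ using 1
  simp [beatingField]

theorem hasDerivAt_shift {C : ℝ} {φ θ : ℝ → ℝ}
    (h : ∀ t, HasDerivAt (fun t ↦ (φ t, θ t)) (beatingField C (φ t, θ t)) t) (s t : ℝ) :
    HasDerivAt (fun t ↦ (φ (t + s), θ (t + s))) (beatingField C (φ (t + s), θ (t + s))) t :=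
  (h (t + s)).comp_add_const t s

/-- Conservation of energy along integral curves of the beating field. -/
theorem energy_eq {C : ℝ} {φ θ : ℝ → ℝ}
    (h : ∀ t, HasDerivAt (fun t ↦ (φ t, θ t)) (beatingField C (φ t, θ t)) t) (s t : ℝ) :
    cos (θ s) ^ 2 * (C + 2 * cos (θ s) * cos (2 * φ s)) =
      cos (θ t) ^ 2 * (C + 2 * cos (θ t) * cos (2 * φ t)) := by
  have hd (r : ℝ) : HasDerivAt
      (fun r ↦ cos (θ r) ^ 2 * (C + 2 * cos (θ r) * cos (2 * φ r))) 0 r := by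
    have hφ := ((hasDerivAt_fst (h r)).const_mul 2).cos
    have hθ := (hasDerivAt_snd (h r)).cos
    convert! (hθ.pow 2).mul (((hθ.const_mul 2).mul hφ).const_add C) using 1
    simp
    ring
  exact is_const_of_deriv_eq_zero (fun r ↦ (hd r).differentiableAt) (fun r ↦ (hd r).deriv) s t

/-- An integral curve with energy larger than `C` that starts on the positive `θ`-axis stays in
the strip `|θ| < π / 2` and reaches the line `θ = 0`. -/
theorem cos_pos_and_exists_eq_zero {C : ℝ} (hC : 9 ≤ C) {φ θ : ℝ → ℝ}
    (h : ∀ t, HasDerivAt (fun t ↦ (φ t, θ t)) (beatingField C (φ t, θ t)) t)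
    (hφ₀ : φ 0 = 0) (hθ₀ : 0 < θ 0) (hθ₀' : θ 0 < π / 2)
    (hE : C < cos (θ 0) ^ 2 * (C + 2 * cos (θ 0))) :
    (∀ t, 0 < cos (θ t)) ∧ ∃ t, 0 < t ∧ θ t = 0 := by
  have hφd (t : ℝ) := hasDerivAt_fst (h t)
  have hθd (t : ℝ) := hasDerivAt_snd (h t)
  have hφc : Continuous φ := continuous_iff_continuousAt.mpr fun t ↦ (hφd t).continuousAt
  have hθc : Continuous θ := continuous_iff_continuousAt.mpr fun t ↦ (hθd t).continuousAt
  have energy (t : ℝ) : C < cos (θ t) ^ 2 * (C + 2 * cos (θ t) * cos (2 * φ t)) := by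
    simpa [energy_eq h t 0, hφ₀] using hE
  have prod_pos (t : ℝ) : 0 < cos (θ t) * cos (2 * φ t) := by
    have h₁ := cos_sq_le_one (θ t)
    by_contra! hn
    nlinarith [energy t, sq_nonneg (cos (θ t))]
  have cosθ_pos : ∀ t, 0 < cos (θ t) := by
    refine (continuous_cos.comp hθc).pos_of_ne_zero (a := 0)
      (cos_pos_of_mem_Ioo ⟨by linarith, hθ₀'⟩) fun t ht ↦ ?_
    have := prod_pos t
    simp_all
  have cosφ_pos (t : ℝ) : 0 < cos (2 * φ t) := (pos_iff_pos_of_mul_pos (prod_pos t)).mp <|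
    cosθ_pos t
  have cosθ_sq (t : ℝ) : 1 / 2 ≤ cos (θ t) ^ 2 := by
    have h₁ : cos (θ t) * cos (2 * φ t) ≤ 1 :=
      mul_le_one₀ (cos_le_one _) (cosφ_pos t).le (cos_le_one _)
    nlinarith [energy t, sq_nonneg (cos (θ t))]
  have φ_lt (t : ℝ) : 0 < π / 4 - φ t := by
    refine Continuous.pos_of_ne_zero (f := fun t ↦ π / 4 - φ t) (a := 0)
      (by fun_prop) (by simp [hφ₀, pi_pos]) (fun s hs ↦ ?_) t
    have h₁ : 2 * φ s = π / 2 := by linarith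
    have := cosφ_pos s
    simp [h₁] at this
  have θ_lt (t : ℝ) : 0 < π / 2 - θ t := by
    refine Continuous.pos_of_ne_zero (f := fun t ↦ π / 2 - θ t) (a := 0)
      (by fun_prop) (by linarith) (fun s hs ↦ ?_) t
    have h₁ : θ s = π / 2 := by linarith
    have := cosθ_pos s
    simp [h₁] at this
  refine ⟨cosθ_pos, ?_⟩
  by_contra! hne
  have θ_pos (t : ℝ) (ht : 0 ≤ t) : 0 < θ t := by
    by_contra! hn
    obtain ⟨s, hs, hs'⟩ := intermediate_value_Icc' ht hθc.continuousOn ⟨hn, hθ₀.le⟩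
    rcases hs.1.eq_or_lt with rfl | hs0
    · exact hθ₀.ne' hs'
    · exact hne s hs0 hs'
  have φ_mono : StrictMonoOn φ (Set.Ici 0) := by
    refine strictMonoOn_of_deriv_pos (convex_Ici 0) hφc.continuousOn fun t ht ↦ ?_
    rw [interior_Ici, Set.mem_Ioi] at ht
    rw [(hφd t).deriv]
    have h₁ : 0 < sin (θ t) :=
      sin_pos_of_pos_of_lt_pi (θ_pos t ht.le) (by linarith [θ_lt t, pi_pos])
    have h₂ : 0 < C + 3 * cos (θ t) * cos (2 * φ t) := by nlinarith [prod_pos t]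
    positivity
  have φ_one : 0 < φ 1 := by
    simpa [hφ₀] using φ_mono (Set.mem_Ici.mpr le_rfl) (Set.mem_Ici.mpr zero_le_one) zero_lt_one
  have sin_one : 0 < sin (2 * φ 1) :=
    sin_pos_of_pos_of_lt_pi (by linarith) (by linarith [φ_lt 1, pi_pos])
  have deriv_le (t : ℝ) (ht : t ∈ interior (Set.Ici (1 : ℝ))) :
      deriv θ t ≤ -(9 / 4) * sin (2 * φ 1) := by
    rw [interior_Ici, Set.mem_Ioi] at ht
    rw [(hθd t).deriv]
    have h₁ : φ 1 ≤ φ t := φ_mono.monotoneOn (Set.mem_Ici.mpr zero_le_one)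
      (Set.mem_Ici.mpr (by linarith)) ht.le
    have h₂ : sin (2 * φ 1) ≤ sin (2 * φ t) :=
      sin_le_sin_of_le_of_le_pi_div_two (by linarith [pi_pos]) (by linarith [φ_lt t]) (by linarith)
    nlinarith [cosθ_sq t]
  set c := 9 / 4 * sin (2 * φ 1) with hc
  have hc0 : 0 < c := by positivity
  have hT : 1 ≤ 1 + θ 1 / c := by
    have := θ_pos 1 zero_le_one
    have : 0 ≤ θ 1 / c := by positivity
    linarith
  have decay := (convex_Ici (1 : ℝ)).image_sub_le_mul_sub_of_deriv_le hθc.continuousOn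
    (fun t _ ↦ (hθd t).differentiableAt.differentiableWithinAt) deriv_le 1 (Set.mem_Ici.mpr le_rfl)
    (1 + θ 1 / c) (Set.mem_Ici.mpr hT) hT
  have h₁ : -(9 / 4) * sin (2 * φ 1) * (1 + θ 1 / c - 1) = -θ 1 := by
    rw [show -(9 / 4) * sin (2 * φ 1) = -c by rw [hc]; ring]
    field_simp
    ring
  linarith [θ_pos (1 + θ 1 / c) (by linarith)]

/-- Small-amplitude orbits of the beating field are antiperiodic. -/
theorem exists_antiperiodic {C : ℝ} (hC : 9 ≤ C) {a : ℝ} (ha : 0 < a) (ha' : a < π / 2)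
    (hE : C < cos a ^ 2 * (C + 2 * cos a)) :
    ∃ (T : ℝ) (φ θ : ℝ → ℝ), 0 < T ∧ φ 0 = 0 ∧ θ 0 = a ∧ (∀ t, 0 < cos (θ t)) ∧
      (∀ t, HasDerivAt (fun t ↦ (φ t, θ t)) (beatingField C (φ t, θ t)) t) ∧
      ∀ t, φ (t + T) = -φ t ∧ θ (t + T) = -θ t := by
  have hC0 : 0 ≤ C := by linarith
  obtain ⟨α, h₀, hα⟩ := exists_integralCurve_of_lipschitzWith_of_bounded (lipschitzWith hC0)
    (L := (9 / 4 * C + 5).toNNReal)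
    (fun p ↦ by rw [coe_toNNReal _ (by linarith)]; exact norm_le hC0 p) ((0 : ℝ), a)
  set φ : ℝ → ℝ := fun t ↦ (α t).1
  set θ : ℝ → ℝ := fun t ↦ (α t).2
  have h : ∀ t, HasDerivAt (fun t ↦ (φ t, θ t)) (beatingField C (φ t, θ t)) t := hα
  have hφ₀ : φ 0 = 0 := by simp [φ, h₀]
  have hθ₀ : θ 0 = a := by simp [θ, h₀]
  obtain ⟨hcos, s, hs, hs0⟩ := cos_pos_and_exists_eq_zero hC h hφ₀ (by rwa [hθ₀]) (by rwa [hθ₀])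
    (by rwa [hθ₀])
  have turn := integralCurve_unique hC0 h (hasDerivAt_reflect h (2 * s)) (t₀ := s)
    (by ring_nf) (by simp [two_mul, hs0]) (2 * s)
  rw [sub_self] at turn
  refine ⟨2 * s, φ, θ, by positivity, hφ₀, hθ₀, hcos, h, ?_⟩
  exact integralCurve_unique hC0 (hasDerivAt_shift h (2 * s)) (hasDerivAt_neg h) (t₀ := 0)
    (by simp [turn.1, hφ₀]) (by simp [turn.2])

/-- Integral curves of the beating field in the strip `|θ| < π / 2` give solutions of the
original system. -/
theorem hasDerivAt_phase {C : ℝ} {φ θ : ℝ → ℝ} {t : ℝ}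
    (h : HasDerivAt (fun t ↦ (φ t, θ t)) (beatingField C (φ t, θ t)) t) (hcos : 0 < cos (θ t)) :
    HasDerivAt φ (-(9 / 4) * (1 - 2 * ((1 + sin (θ t)) / 2)) *
      (C + 6 * √((1 + sin (θ t)) / 2 * (1 - (1 + sin (θ t)) / 2)) * cos (2 * φ t))) t ∧
    HasDerivAt (fun t ↦ (1 + sin (θ t)) / 2)
      (-18 * ((1 + sin (θ t)) / 2 * (1 - (1 + sin (θ t)) / 2)) ^ ((3 : ℝ) / 2)
        * sin (2 * φ t)) t := by
  have hw : (1 + sin (θ t)) / 2 * (1 - (1 + sin (θ t)) / 2) = (cos (θ t) / 2) ^ 2 := by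
    linear_combination -sin_sq_add_cos_sq (θ t) / 4
  have hw0 : 0 ≤ cos (θ t) / 2 := by positivity
  have hpow : ((cos (θ t) / 2) ^ 2) ^ ((3 : ℝ) / 2) = (cos (θ t) / 2) ^ 3 := by
    rw [← rpow_natCast, ← rpow_mul hw0, ← rpow_natCast]
    norm_num
  rw [hw, sqrt_sq hw0, hpow]
  constructor
  · convert hasDerivAt_fst h using 1
    ring
  · convert! ((hasDerivAt_snd h).sin.const_add 1).div_const 2 using 1
    ring

end beatingField

/-- For `C ≥ 9`, there is `γ ∈ (0, 1/2)` such that for every initial datum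
`K₀ ∈ (γ, 1−γ)` with `K₀ ≠ 1/2`, the planar system
`φ′ = −(9/4)(1−2K)[C + 6(K(1−K))^{1/2} cos(2φ)]`,
`K′ = −18(K(1−K))^{3/2} sin(2φ)` with `φ(0) = 0`, `K(0) = K₀` has a
`2T`-periodic solution (for some `T > 0`) satisfying `K(0) + K(T) = 1`. -/
theorem exists_periodic_beating_orbit (C : ℝ) (hC : 9 ≤ C) :
    ∃ γ : ℝ, 0 < γ ∧ γ < 1 / 2 ∧
      ∀ K₀ : ℝ, γ < K₀ → K₀ < 1 - γ → K₀ ≠ 1 / 2 →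
        ∃ (T : ℝ) (φ K : ℝ → ℝ),
          0 < T ∧
          (∀ t, 0 < K t ∧ K t < 1) ∧
          (∀ t, HasDerivAt φ
            (-(9 / 4) * (1 - 2 * K t) *
              (C + 6 * Real.sqrt (K t * (1 - K t)) * Real.cos (2 * φ t))) t) ∧
          (∀ t, HasDerivAt K
            (-18 * (K t * (1 - K t)) ^ ((3 : ℝ) / 2) * Real.sin (2 * φ t)) t) ∧
          φ 0 = 0 ∧ K 0 = K₀ ∧
          (∀ t, φ (t + 2 * T) = φ t) ∧
          (∀ t, K (t + 2 * T) = K t) ∧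
          K 0 + K T = 1 := by
  have hδ : 0 < 1 / (2 * (C + 1)) := by positivity
  have hδ' : 1 / (2 * (C + 1)) ≤ 1 / 20 := one_div_le_one_div_of_le (by norm_num) (by linarith)
  refine ⟨1 / 2 - 1 / (2 * (C + 1)), by linarith, by linarith, fun K₀ hK₁ hK₂ hK ↦ ?_⟩
  set x := |2 * K₀ - 1| with hx
  have hx0 : 0 < x := abs_pos.mpr fun h ↦ hK (by linarith)
  have hxC : x * (C + 1) < 1 := by
    rw [← lt_div_iff₀ (by linarith), hx, abs_lt]
    have : 1 / (C + 1) = 2 * (1 / (2 * (C + 1))) := by field_simp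
    constructor <;> linarith
  have hx1 : x < 1 / 10 := by nlinarith
  have hsin : Real.sin (Real.arcsin x) = x := Real.sin_arcsin (by linarith) (by linarith)
  have ha : 0 < Real.arcsin x := Real.arcsin_pos.mpr hx0
  have ha' : Real.arcsin x < Real.pi / 2 := Real.arcsin_lt_pi_div_two.mpr (by linarith)
  have hcos : 0 < Real.cos (Real.arcsin x) :=
    Real.cos_pos_of_mem_Ioo ⟨by linarith [Real.pi_pos], ha'⟩
  have hcos_sq : Real.cos (Real.arcsin x) ^ 2 = 1 - x ^ 2 := by rw [Real.cos_sq', hsin]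
  have hE : C < Real.cos (Real.arcsin x) ^ 2 * (C + 2 * Real.cos (Real.arcsin x)) := by
    have h₁ : 9 / 10 ≤ Real.cos (Real.arcsin x) := by nlinarith
    have h₂ : C * x ^ 2 < 1 := by nlinarith
    rw [hcos_sq]
    nlinarith
  obtain ⟨T, φ, θ, hT, hφ₀, hθ₀, hpos, hd, hanti⟩ :=
    beatingField.exists_antiperiodic hC ha ha' hE
  obtain ⟨φ, θ, hφ₀, hθ₀, hpos, hd, hanti⟩ : ∃ φ θ : ℝ → ℝ, φ 0 = 0 ∧
      Real.sin (θ 0) = 2 * K₀ - 1 ∧ (∀ t, 0 < Real.cos (θ t)) ∧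
      (∀ t, HasDerivAt (fun t ↦ (φ t, θ t)) (beatingField C (φ t, θ t)) t) ∧
      ∀ t, φ (t + T) = -φ t ∧ θ (t + T) = -θ t := by
    rcases abs_choice (2 * K₀ - 1) with h | h
    · exact ⟨φ, θ, hφ₀, by rw [hθ₀, hsin, hx, h], hpos, hd, hanti⟩
    · refine ⟨fun t ↦ -φ t, fun t ↦ -θ t, by simp [hφ₀], ?_, fun t ↦ by simpa using hpos t,
        beatingField.hasDerivAt_neg hd, fun t ↦ by simp [hanti t]⟩
      rw [Real.sin_neg, hθ₀, hsin, hx, h, neg_neg]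
  have hper (t : ℝ) : φ (t + 2 * T) = φ t ∧ θ (t + 2 * T) = θ t := by
    rw [two_mul, ← add_assoc]
    simp [hanti]
  refine ⟨T, φ, fun t ↦ (1 + Real.sin (θ t)) / 2, hT, fun t ↦ ?_,
    fun t ↦ (beatingField.hasDerivAt_phase (hd t) (hpos t)).1,
    fun t ↦ (beatingField.hasDerivAt_phase (hd t) (hpos t)).2, hφ₀, ?_,
    fun t ↦ (hper t).1, fun t ↦ ?_, ?_⟩
  · have h₁ : |Real.sin (θ t)| < 1 := by
      rw [← sq_lt_one_iff_abs_lt_one, Real.sin_sq]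
      linarith [pow_pos (hpos t) 2]
    rw [abs_lt] at h₁
    constructor <;> linarith
  · simp only [hθ₀]
    ring
  · simp only [(hper t).2]
  · have h₁ := (hanti 0).2
    rw [zero_add] at h₁
    simp only [h₁, Real.sin_neg]
    ring
end

section
/- Fix a real parameter C ≥ 9 and let γ ∈ (0,1/2) be as in the existence result for periodic orbits of the planar system φ′ = −(9/4)(1−2K)[C + 6(K(1−K))^{1/2} cos(2φ)], K′ = −18(K(1−K))^{3/2} sin(2φ). For every δ > 0 there exists η > 0 such that for every K₀ with 0 < |K₀ − 1/2| < η, there exist T > 0 with |T − 2π/(9√(C+3))| < δ and a solution (φ, K) : ℝ → ℝ × (0,1) with φ(0) = 0, K(0) = K₀, such that φ and K are 2T-periodic and K(0) + K(T) = 1. In other words, the half-period T of these orbits tends to 2π/(9√(C+3)) as K₀ → 1/2. -/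
/-- A positive continuous function which is `P`-periodic is the reciprocal speed of a motion `θ` on
the line; `θ` advances by `P` in time `∫₀ᴾ h`. -/
lemma exists_time_change {h : ℝ → ℝ} (hc : Continuous h) (hpos : ∀ x, 0 < h x) {P : ℝ}
    (hP : 0 < P) (hper : Function.Periodic h P) :
    ∃ θ : ℝ → ℝ, θ 0 = 0 ∧ (∀ t, HasDerivAt θ (h (θ t))⁻¹ t) ∧
      ∀ t, θ (t + ∫ x in (0 : ℝ)..P, h x) = θ t + P := by
  have hint : ∀ a b, IntervalIntegrable h MeasureTheory.volume a b :=
    fun a b => hc.intervalIntegrable a b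
  set I : ℝ → ℝ := fun x => ∫ y in (0 : ℝ)..x, h y with hI
  have hderiv : ∀ x, HasDerivAt I (h x) x := fun x =>
    intervalIntegral.integral_hasDerivAt_right (hint _ _)
      hc.stronglyMeasurable.stronglyMeasurableAtFilter hc.continuousAt
  have hmono : StrictMono I := strictMono_of_hasDerivAt_pos hderiv hpos
  have hcont : Continuous I := continuous_iff_continuousAt.2 fun x => (hderiv x).continuousAt
  have hsurj : Function.Surjective I :=
    hcont.surjective (hper.tendsto_atTop_intervalIntegral_of_pos' (hint _ _) hpos hP)
      (hper.tendsto_atBot_intervalIntegral_of_pos' (hint _ _) hpos hP)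
  let e := hmono.orderIsoOfSurjective I hsurj
  have he : ∀ t, I (e.symm t) = t := fun t => e.apply_symm_apply t
  have he' : ∀ x, e.symm (I x) = x := fun x => e.symm_apply_apply x
  refine ⟨e.symm, ?_, fun t => ?_, fun t => ?_⟩
  · simpa [hI] using he' 0
  · exact HasDerivAt.of_local_left_inverse e.symm.continuous.continuousAt (hderiv _)
      (hpos _).ne' (Filter.Eventually.of_forall he)
  · have key : I (e.symm t + P) = t + ∫ x in (0 : ℝ)..P, h x := by
      have hadd : I (e.symm t) + ∫ x in e.symm t..e.symm t + P, h x = I (e.symm t + P) :=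
        intervalIntegral.integral_add_adjacent_intervals (hint _ _) (hint _ _)
      rw [← hadd, hper.intervalIntegral_add_eq (e.symm t) 0, zero_add, he]
    rw [← key, he']

/-- The ratio `sin φ / (k₀ sin θ)` on the level set of the energy through `(0, 1/2 + k₀)`, where
`K = 1/2 + k₀ cos θ`, `a = √(K(1-K))` and `b = √(1/4 - k₀²)`. -/
noncomputable def orbitRatio (C a b : ℝ) : ℝ :=
  Real.sqrt ((C + 4 * (a ^ 2 + a * b + b ^ 2) / (a + b)) / (8 * a ^ 3))

/-- The angular speed `θ′` on an orbit, as a function of `p = k₀ cos θ` and `q = k₀ sin θ`. -/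
noncomputable def angularSpeed (C p q : ℝ) : ℝ :=
  36 * Real.sqrt (1 / 4 - p ^ 2) ^ 3 *
    orbitRatio C (Real.sqrt (1 / 4 - p ^ 2)) (Real.sqrt (1 / 4 - (p ^ 2 + q ^ 2))) *
    Real.sqrt (1 - (q * orbitRatio C (Real.sqrt (1 / 4 - p ^ 2))
      (Real.sqrt (1 / 4 - (p ^ 2 + q ^ 2)))) ^ 2)

lemma sqrt_one_fourth : Real.sqrt (1 / 4) = 1 / 2 := by
  rw [show (1 / 4 : ℝ) = (1 / 2) ^ 2 by norm_num]
  exact Real.sqrt_sq (by norm_num)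

lemma orbitRatio_pos {C a b : ℝ} (hC : 0 < C) (ha : 0 < a) (hb : 0 < b) :
    0 < orbitRatio C a b := Real.sqrt_pos.2 (by positivity)

lemma orbitRatio_sq {C a b : ℝ} (hC : 0 < C) (ha : 0 < a) (hb : 0 < b) :
    orbitRatio C a b ^ 2 = (C + 4 * (a ^ 2 + a * b + b ^ 2) / (a + b)) / (8 * a ^ 3) :=
  Real.sq_sqrt (by positivity)

lemma hasDerivAt_orbitRatio {C a b : ℝ} (hC : 0 < C) (ha : 0 < a) (hb : 0 < b) :
    HasDerivAt (fun x => orbitRatio C x b)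
      ((4 * (a ^ 2 + 2 * a * b) / (a + b) ^ 2 / (8 * a ^ 3) -
        3 / a * orbitRatio C a b ^ 2) / (2 * orbitRatio C a b)) a := by
  have hab : a + b ≠ 0 := by positivity
  have h1 : HasDerivAt (fun x : ℝ => x ^ 2 + x * b + b ^ 2) (2 * a + b) a := by
    simpa using ((hasDerivAt_pow 2 a).add ((hasDerivAt_id a).mul_const b)).add_const (b ^ 2)
  have h2 : HasDerivAt (fun x : ℝ => x + b) 1 a := (hasDerivAt_id a).add_const b
  have h3 := ((h1.const_mul 4).div h2 hab).const_add C
  have h4 : HasDerivAt (fun x : ℝ => 8 * x ^ 3) (8 * (3 * a ^ 2)) a := by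
    simpa using (hasDerivAt_pow 3 a).const_mul 8
  have h5 : HasDerivAt (fun x => orbitRatio C x b) _ a := (h3.div h4 (by positivity)).sqrt
    (show 0 < (C + 4 * (a ^ 2 + a * b + b ^ 2) / (a + b)) / (8 * a ^ 3) by positivity).ne'
  refine h5.congr_deriv ?_
  change _ / (2 * orbitRatio C a b) = _
  rw [orbitRatio_sq hC ha hb]
  congr 1
  simp only [Pi.div_apply]
  field_simp
  ring

lemma continuousAt_angularSpeed (C : ℝ) {p q : ℝ} (h : p ^ 2 + q ^ 2 < 1 / 4) :
    ContinuousAt (fun z : ℝ × ℝ => angularSpeed C z.1 z.2) (p, q) := by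
  have ha : 0 < Real.sqrt (1 / 4 - p ^ 2) := Real.sqrt_pos.2 (by nlinarith [sq_nonneg q])
  have hb : 0 < Real.sqrt (1 / 4 - (p ^ 2 + q ^ 2)) := Real.sqrt_pos.2 (by linarith)
  have h1 : ContinuousAt (fun z : ℝ × ℝ => orbitRatio C (Real.sqrt (1 / 4 - z.1 ^ 2))
      (Real.sqrt (1 / 4 - (z.1 ^ 2 + z.2 ^ 2)))) (p, q) := by
    unfold orbitRatio
    refine ContinuousAt.sqrt (ContinuousAt.div (continuousAt_const.add
      (ContinuousAt.div (by fun_prop) (by fun_prop) ?_)) (by fun_prop) ?_) <;>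
    · dsimp only
      positivity
  unfold angularSpeed
  fun_prop

lemma angularSpeed_zero (C : ℝ) : angularSpeed C 0 0 = 9 / 2 * Real.sqrt (C + 3) := by
  unfold angularSpeed orbitRatio
  norm_num [sqrt_one_fourth]

/-- Near the center the curve `sin φ = q · orbitRatio` is defined and the angular speed is positive
with reciprocal close to its value at the center. -/
lemma exists_radius {C : ℝ} (hC : 0 < C) {ε : ℝ} (hε : 0 < ε) :
    ∃ η > 0, ∀ p q : ℝ, p ^ 2 + q ^ 2 < η ^ 2 → p ^ 2 + q ^ 2 < 1 / 4 ∧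
      (q * orbitRatio C (Real.sqrt (1 / 4 - p ^ 2))
        (Real.sqrt (1 / 4 - (p ^ 2 + q ^ 2)))) ^ 2 < 1 ∧ 0 < angularSpeed C p q ∧
      |(angularSpeed C p q)⁻¹ - 2 / (9 * Real.sqrt (C + 3))| < ε := by
  have h0 : 0 < angularSpeed C 0 0 := by rw [angularSpeed_zero]; positivity
  have hca := continuousAt_angularSpeed C (p := 0) (q := 0) (by norm_num)
  have h1 := hca.eventually (lt_mem_nhds h0)
  have h2 := (hca.inv₀ h0.ne').eventually (Metric.ball_mem_nhds _ hε)
  have h3 : ∀ᶠ z : ℝ × ℝ in nhds (0, 0), z.1 ^ 2 + z.2 ^ 2 < 1 / 4 :=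
    ContinuousAt.eventually_lt (by fun_prop) (by fun_prop) (by norm_num)
  obtain ⟨η, hη, H⟩ := Metric.eventually_nhds_iff.1 (h1.and (h2.and h3))
  refine ⟨η, hη, fun p q hpq => ?_⟩
  have hp : |p| < η := abs_lt_of_sq_lt_sq (by nlinarith [sq_nonneg q]) hη.le
  have hq : |q| < η := abs_lt_of_sq_lt_sq (by nlinarith [sq_nonneg p]) hη.le
  obtain ⟨g1, g2, g3⟩ := @H (p, q) (by simpa [Prod.dist_eq] using ⟨hp, hq⟩)
  refine ⟨g3, ?_, g1, ?_⟩
  · by_contra! hcon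
    have : angularSpeed C p q = 0 := by
      unfold angularSpeed
      rw [Real.sqrt_eq_zero_of_nonpos (x := 1 - _) (by linarith), mul_zero]
    exact g1.ne' this
  · have : (angularSpeed C 0 0)⁻¹ = 2 / (9 * Real.sqrt (C + 3)) := by
      rw [angularSpeed_zero]
      field_simp
    rw [← this]
    exact g2

/-- The derivative of the curve `sin φ = k sin θ · orbitRatio`, multiplied by the factor
`36 a³ · orbitRatio` of the angular speed. -/
lemma hasDerivAt_sin_phase {C k x : ℝ} (hC : 0 < C) (hk : k ^ 2 < 1 / 4) :
    ∃ S', HasDerivAt (fun y => k * Real.sin y *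
        orbitRatio C (Real.sqrt (1 / 4 - (k * Real.cos y) ^ 2)) (Real.sqrt (1 / 4 - k ^ 2))) S' x ∧
      S' * (36 * Real.sqrt (1 / 4 - (k * Real.cos x) ^ 2) ^ 3 *
        orbitRatio C (Real.sqrt (1 / 4 - (k * Real.cos x) ^ 2)) (Real.sqrt (1 / 4 - k ^ 2))) =
      9 / 2 * (k * Real.cos x) * (C + 6 * Real.sqrt (1 / 4 - (k * Real.cos x) ^ 2) *
        (1 - 2 * (k * Real.sin x * orbitRatio C (Real.sqrt (1 / 4 - (k * Real.cos x) ^ 2))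
          (Real.sqrt (1 / 4 - k ^ 2))) ^ 2)) := by
  have hsc := Real.sin_sq_add_cos_sq x
  have hma : 0 < 1 / 4 - (k * Real.cos x) ^ 2 := by
    nlinarith [mul_nonneg (sq_nonneg k) (sq_nonneg (Real.sin x))]
  have hd : HasDerivAt (fun y => 1 / 4 - (k * Real.cos y) ^ 2)
      (2 * k ^ 2 * Real.cos x * Real.sin x) x := by
    refine ((((Real.hasDerivAt_cos x).const_mul k).pow 2).const_sub (1 / 4)).congr_deriv ?_
    norm_num
    ring
  have hda := hd.sqrt hma.ne'
  have hb : 0 < Real.sqrt (1 / 4 - k ^ 2) := Real.sqrt_pos.2 (by linarith)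
  have ha : 0 < Real.sqrt (1 / 4 - (k * Real.cos x) ^ 2) := Real.sqrt_pos.2 hma
  have hasq := Real.sq_sqrt hma.le
  have hbsq := Real.sq_sqrt (show 0 ≤ 1 / 4 - k ^ 2 by linarith)
  have hR := HasDerivAt.comp x (hasDerivAt_orbitRatio hC ha hb) hda
  refine ⟨_, ((Real.hasDerivAt_sin x).const_mul k).mul hR, ?_⟩
  have hRpos := orbitRatio_pos hC ha hb
  have hRsq := orbitRatio_sq hC ha hb
  generalize Real.sqrt (1 / 4 - (k * Real.cos x) ^ 2) = a at *
  generalize Real.sqrt (1 / 4 - k ^ 2) = b at *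
  generalize orbitRatio C a b = R at *
  generalize Real.sin x = s at *
  generalize Real.cos x = c at *
  have hks : k ^ 2 * s ^ 2 = a ^ 2 - b ^ 2 := by
    rw [hasq, hbsq]; linear_combination k ^ 2 * hsc
  have hQ : 8 * a ^ 3 * R ^ 2 * (a + b) = C * (a + b) + 4 * (a ^ 2 + a * b + b ^ 2) := by
    rw [hRsq]; field_simp
  have key : 8 * a ^ 3 * R ^ 2 + (k ^ 2 * s ^ 2) / (2 * a) *
      (4 * (a ^ 2 + 2 * a * b) / (a + b) ^ 2 - 24 * a ^ 2 * R ^ 2) =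
      C + 6 * a * (1 - 2 * (k ^ 2 * s ^ 2) * R ^ 2) := by
    rw [hks]
    have hab : a + b ≠ 0 := by positivity
    field_simp
    linear_combination 2 * (a + b) * hQ
  have : ∀ X : ℝ, (k * c * R + k * s * ((X / (8 * a ^ 3) - 3 / a * R ^ 2) / (2 * R) *
      (2 * k ^ 2 * c * s / (2 * a)))) * (36 * a ^ 3 * R) = 9 / 2 * (k * c) *
      (8 * a ^ 3 * R ^ 2 + (k ^ 2 * s ^ 2) / (2 * a) * (X - 24 * a ^ 2 * R ^ 2)) := by
    intro X
    field_simp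
    ring
  rw [this, key]
  ring


/-- For `C ≥ 9`, the half-period `T` of the beating orbits of the planar system
`φ′ = −(9/4)(1−2K)[C + 6(K(1−K))^{1/2} cos(2φ)]`, `K′ = −18(K(1−K))^{3/2} sin(2φ)`
tends to `2π/(9√(C+3))` as the initial datum `K₀` tends to `1/2`: for every `δ > 0`
there is `η > 0` such that for every `K₀` with `0 < |K₀ − 1/2| < η` there is a
`2T`-periodic solution with `φ(0) = 0`, `K(0) = K₀`, `K(0) + K(T) = 1` and
`|T − 2π/(9√(C+3))| < δ`. -/
theorem period_limit_at_center (C : ℝ) (hC : 9 ≤ C) :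
    ∀ δ : ℝ, 0 < δ →
      ∃ η : ℝ, 0 < η ∧
        ∀ K₀ : ℝ, 0 < |K₀ - 1 / 2| → |K₀ - 1 / 2| < η →
          ∃ (T : ℝ) (φ K : ℝ → ℝ),
            0 < T ∧
            |T - 2 * Real.pi / (9 * Real.sqrt (C + 3))| < δ ∧
            (∀ t, 0 < K t ∧ K t < 1) ∧
            (∀ t, HasDerivAt φ
              (-(9 / 4) * (1 - 2 * K t) *
                (C + 6 * Real.sqrt (K t * (1 - K t)) * Real.cos (2 * φ t))) t) ∧
            (∀ t, HasDerivAt K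
              (-18 * (K t * (1 - K t)) ^ ((3 : ℝ) / 2) * Real.sin (2 * φ t)) t) ∧
            φ 0 = 0 ∧ K 0 = K₀ ∧
            (∀ t, φ (t + 2 * T) = φ t) ∧
            (∀ t, K (t + 2 * T) = K t) ∧
            K 0 + K T = 1 := by
  intro δ hδ
  have hC0 : 0 < C := by linarith
  obtain ⟨η, hη, H⟩ := exists_radius hC0 (show 0 < δ / 4 by positivity)
  refine ⟨η, hη, fun K₀ _ hK₀ => ?_⟩
  obtain ⟨k, rfl⟩ : ∃ k, K₀ = 1 / 2 + k := ⟨K₀ - 1 / 2, by ring⟩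
  rw [add_sub_cancel_left] at hK₀
  have hpq : ∀ x, (k * Real.cos x) ^ 2 + (k * Real.sin x) ^ 2 = k ^ 2 := fun x => by
    linear_combination k ^ 2 * Real.sin_sq_add_cos_sq x
  have hkη : k ^ 2 < η ^ 2 := sq_lt_sq' (abs_lt.1 hK₀).1 (abs_lt.1 hK₀).2
  have H' := fun x => H (k * Real.cos x) (k * Real.sin x) (by rwa [hpq])
  simp only [hpq] at H'
  have hk : k ^ 2 < 1 / 4 := (H' 0).1
  have hma : ∀ x, 0 < 1 / 4 - (k * Real.cos x) ^ 2 := fun x => by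
    nlinarith [hpq x, sq_nonneg (k * Real.sin x)]
  set h : ℝ → ℝ := fun x => (angularSpeed C (k * Real.cos x) (k * Real.sin x))⁻¹ with hh
  have hpos : ∀ x, 0 < h x := fun x => inv_pos.2 (H' x).2.2.1
  have hcont : Continuous h := continuous_iff_continuousAt.2 fun x =>
    ContinuousAt.inv₀ (ContinuousAt.comp
      (f := fun x : ℝ => (k * Real.cos x, k * Real.sin x))
      (continuousAt_angularSpeed C (by rwa [hpq])) (by fun_prop)) (H' x).2.2.1.ne'
  have hper : Function.Periodic h Real.pi := fun x => by
    simp [hh, angularSpeed, Real.cos_add_pi, Real.sin_add_pi]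
  obtain ⟨θ, hθ0, hθ, hθT⟩ := exists_time_change hcont hpos Real.pi_pos hper
  set T := ∫ x in (0 : ℝ)..Real.pi, h x with hT
  have hTpos : 0 < T := intervalIntegral.intervalIntegral_pos_of_pos
    (hcont.intervalIntegrable _ _) hpos Real.pi_pos
  have hθ2 : ∀ t, θ (t + 2 * T) = θ t + 2 * Real.pi := fun t => by
    rw [two_mul, ← add_assoc, hθT, hθT]; ring
  set S : ℝ → ℝ := fun y => k * Real.sin y *
    orbitRatio C (Real.sqrt (1 / 4 - (k * Real.cos y) ^ 2)) (Real.sqrt (1 / 4 - k ^ 2)) with hS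
  have hS1 : ∀ y, S y ^ 2 < 1 := fun y => (H' y).2.1
  have hS2 : ∀ y, -1 < S y ∧ S y < 1 := fun y => abs_lt.1 ((sq_lt_one_iff_abs_lt_one _).1 (hS1 y))
  have hsin : ∀ y, Real.sin (Real.arcsin (S y)) = S y :=
    fun y => Real.sin_arcsin (hS2 y).1.le (hS2 y).2.le
  have hm : ∀ y, (1 / 2 + k * Real.cos y) * (1 - (1 / 2 + k * Real.cos y)) =
      1 / 4 - (k * Real.cos y) ^ 2 := fun y => by ring
  have hinv : ∀ y, (h y)⁻¹ = 36 * Real.sqrt (1 / 4 - (k * Real.cos y) ^ 2) ^ 3 *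
      orbitRatio C (Real.sqrt (1 / 4 - (k * Real.cos y) ^ 2)) (Real.sqrt (1 / 4 - k ^ 2)) *
      Real.sqrt (1 - S y ^ 2) := fun y => by
    simp only [hh, hS, inv_inv, angularSpeed, hpq]
  refine ⟨T, fun t => Real.arcsin (S (θ t)), fun t => 1 / 2 + k * Real.cos (θ t), hTpos, ?_,
    fun t => ?_, fun t => ?_, fun t => ?_, ?_, ?_, fun t => ?_, fun t => ?_, ?_⟩
  · have hdiff : T - 2 * Real.pi / (9 * Real.sqrt (C + 3)) =
        ∫ x in (0 : ℝ)..Real.pi, (h x - 2 / (9 * Real.sqrt (C + 3))) := by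
      rw [intervalIntegral.integral_sub (hcont.intervalIntegrable _ _) (by simp),
        intervalIntegral.integral_const, smul_eq_mul]
      ring
    have hle := intervalIntegral.norm_integral_le_of_norm_le_const
      (a := 0) (b := Real.pi) (f := fun x => h x - 2 / (9 * Real.sqrt (C + 3))) (C := δ / 4)
      fun x _ => (H' x).2.2.2.le
    rw [← hdiff, sub_zero, abs_of_pos Real.pi_pos, Real.norm_eq_abs] at hle
    nlinarith [Real.pi_lt_four]
  · have := hma (θ t)
    constructor <;> nlinarith
  · obtain ⟨S', hS', hval⟩ := hasDerivAt_sin_phase (x := θ t) hC0 hk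
    have hS'' : HasDerivAt S S' (θ t) := hS'
    have hd := (Real.hasDerivAt_arcsin (hS2 (θ t)).1.ne' (hS2 (θ t)).2.ne).comp t
      (hS''.comp t (hθ t))
    refine hd.congr_deriv ?_
    have hw : Real.sqrt (1 - S (θ t) ^ 2) ≠ 0 :=
      (Real.sqrt_pos.2 (by linarith [hS1 (θ t)])).ne'
    rw [Real.cos_two_mul, Real.cos_sq', hsin, hm, hinv, ← mul_assoc S', hval,
      one_div_mul_eq_div, mul_div_cancel_right₀ _ hw]
    simp only [hS]
    ring
  · have hd := (((Real.hasDerivAt_cos (θ t)).comp t (hθ t)).const_mul k).const_add (1 / 2)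
    refine hd.congr_deriv ?_
    rw [Real.sin_two_mul, hsin, Real.cos_arcsin, hm, hinv,
      show (3 : ℝ) / 2 = 1 / 2 * (3 : ℕ) by norm_num, Real.rpow_mul (hma _).le,
      ← Real.sqrt_eq_rpow, Real.rpow_natCast]
    simp only [hS]
    ring
  · simp [hS, hθ0]
  · simp [hθ0]
  · simp [hS, hθ2]
  · simp [hθ2]
  · have := hθT 0
    rw [zero_add, hθ0, zero_add] at this
    simp only [hθ0, this, Real.cos_zero, Real.cos_pi]
    ring
end
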